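/- arXiv:2307.03977 — 2 statements merged into one kernel-verified Lean document; each statement's English description precedes it below -/
import Mathlib

section
/- Let $p$ be a prime, and let $k, r$ be positive integers with $r \leq k$. Then for every integer $h \geq r$ and every subset $A$ of $\mathbb{Z}/p\mathbb{Z}$ with $|A| = k$, we have $|h^{(\geq r)}A| \geq \min\{p,\; h(k-1) - r(r-1) + 1\}$. -/
open Pointwise

/-- The generalized sumset `h^{(≥ r)}A`: elements expressible as a sum of `h` elements of `A`
(with repetition allowed) using at least `r` distinct elements of `A`. -/
def genSumset {G : Type*} [AddCommGroup G] [DecidableEq G] (h r : ℕ) (A : Finset G) : Set G :=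
  {x | ∃ s : Multiset G, s.toFinset ⊆ A ∧ Multiset.card s = h ∧
      r ≤ s.toFinset.card ∧ s.sum = x}

/-- The `h`-fold sumset `hA`: sums of `h` elements of `A` with repetition allowed
(with the convention `0A = {0}`). -/
def hfoldSumset {G : Type*} [AddCommGroup G] [DecidableEq G] (h : ℕ) (A : Finset G) : Set G :=
  {x | ∃ s : Multiset G, s.toFinset ⊆ A ∧ Multiset.card s = h ∧ s.sum = x}

/-- The `h`-fold restricted sumset `h^A`: sums of `h` pairwise distinct elements of `A`
(with the convention `0^A = {0}`). -/
def restrictedSumset {G : Type*} [AddCommGroup G] [DecidableEq G] (r : ℕ) (A : Finset G) : Set G :=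
  {x | ∃ s : Finset G, s ⊆ A ∧ s.card = r ∧ ∑ a ∈ s, a = x}

open MvPolynomial in
/-- The coefficient of `x ^ c` in `x ^ e * (∑ x_i) ^ m`, cleared of denominators. -/
lemma prod_factorial_mul_coeff_prod_X_pow_mul_sum_pow {R ι : Type*} [CommRing R] [Fintype ι]
    (m : ℕ) (e c : ι →₀ ℕ) (hc : ∑ i, c i = m + ∑ i, e i) :
    ((∏ i, (c i).factorial : ℕ) : R) *
        coeff c ((∏ i, X i ^ e i) * (∑ i, X i : MvPolynomial ι R) ^ m) =
      m.factorial * ∏ i, ((c i).descFactorial (e i) : R) := by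
  classical
  have hmon : (∏ i, X i ^ e i : MvPolynomial ι R) = monomial e 1 := by
    rw [monomial_eq, C_1, one_mul, Finsupp.prod_fintype _ _ (by simp)]
  rw [hmon, coeff_monomial_mul']
  split_ifs with hle
  · have hsum : ∑ i, (c - e) i = m := by
      have : ∑ i, ((c - e) i + e i) = m + ∑ i, e i := by
        rw [← hc]
        exact Finset.sum_congr rfl fun i _ => Nat.sub_add_cancel (hle i)
      rw [Finset.sum_add_distrib] at this
      omega
    have hspec : (∏ i, ((c - e) i).factorial) * (c - e).multinomial = m.factorial := by
      rw [Finsupp.multinomial_eq, ← hsum,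
        ← Finset.sum_subset (Finset.subset_univ (c - e).support) (by simp),
        ← Finset.prod_subset (Finset.subset_univ (c - e).support)
          (fun i _ hi => by rw [Finsupp.notMem_support_iff.mp hi, Nat.factorial_zero])]
      exact Nat.multinomial_spec _ _
    rw [coeff_sum_X_pow_of_fintype,
      if_pos (by rw [Finsupp.sum_fintype _ _ (by simp)]; exact hsum), one_mul, ← hspec,
      ← Finset.prod_congr rfl fun i _ => Nat.factorial_mul_descFactorial (hle i),
      Finset.prod_mul_distrib]
    simp only [Finsupp.tsub_apply]
    push_cast
    ring
  · obtain ⟨i, hi⟩ : ∃ i, c i < e i := by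
      simpa [Finsupp.le_def] using hle
    have h0 : ∏ i, ((c i).descFactorial (e i) : R) = 0 :=
      Finset.prod_eq_zero (Finset.mem_univ i) (by rw [Nat.descFactorial_of_lt hi, Nat.cast_zero])
    rw [h0, mul_zero, mul_zero]

open MvPolynomial in
/-- The coefficient of `x ^ c` in `∏_{i < j} (x_j - x_i) * (∑ x_i) ^ m`, cleared of
denominators. -/
lemma prod_factorial_mul_coeff_vandermonde_mul_sum_pow {R : Type*} [CommRing R] [IsDomain R]
    {r : ℕ} (m : ℕ) (c : Fin r →₀ ℕ) (hc : ∑ i, c i = m + ∑ i : Fin r, (i : ℕ)) :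
    ((∏ i, (c i).factorial : ℕ) : R) *
        coeff c ((Matrix.vandermonde (X : Fin r → MvPolynomial (Fin r) R)).det *
          (∑ i, X i) ^ m) =
      m.factorial * (Matrix.vandermonde fun i => (c i : R)).det := by
  rw [Matrix.det_eval_matrixOfPolynomials_eq_det_vandermonde _
      (fun i : Fin r => descPochhammer R i) (fun i => descPochhammer_natDegree R i)
      (fun i => monic_descPochhammer R i),
    ← Matrix.det_transpose, ← Matrix.det_transpose (Matrix.of _), Matrix.det_apply,
    Matrix.det_apply, Finset.sum_mul, coeff_sum, Finset.mul_sum, Finset.mul_sum]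
  refine Finset.sum_congr rfl fun σ _ => ?_
  have key := prod_factorial_mul_coeff_prod_X_pow_mul_sum_pow (R := R) m
    (Finsupp.equivFunOnFinite.symm fun i => (σ i : ℕ)) c
    (by simpa using hc.trans (by rw [Equiv.sum_comp σ (fun i : Fin r => (i : ℕ))]))
  simp only [Finsupp.equivFunOnFinite_symm_apply_apply] at key
  simp only [Matrix.transpose_apply, Matrix.vandermonde_apply, Matrix.of_apply,
    descPochhammer_eval_eq_descFactorial, smul_mul_assoc, coeff_smul, mul_smul_comm, key]

open MvPolynomial in
lemma isHomogeneous_det_vandermonde_X {R : Type*} [CommRing R] (r : ℕ) :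
    (Matrix.vandermonde (X : Fin r → MvPolynomial (Fin r) R)).det.IsHomogeneous
      (∑ i : Fin r, (i : ℕ)) := by
  rw [← Matrix.det_transpose, Matrix.det_apply]
  refine IsHomogeneous.sum _ _ _ fun σ _ => ?_
  rw [Units.smul_def, zsmul_eq_mul, ← map_intCast (C : R →+* MvPolynomial (Fin r) R)]
  refine IsHomogeneous.C_mul ?_ _
  rw [← Equiv.sum_comp σ (fun i : Fin r => (i : ℕ))]
  refine IsHomogeneous.prod _ _ _ fun i _ => ?_
  simpa using isHomogeneous_X_pow (R := R) i (σ i : ℕ)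

lemma sum_range_add_div (r m : ℕ) (hr : 0 < r) : ∑ i ∈ Finset.range r, (m + i) / r = m := by
  induction m with
  | zero =>
    refine Finset.sum_eq_zero fun i hi => ?_
    rw [zero_add]
    exact Nat.div_eq_of_lt (Finset.mem_range.mp hi)
  | succ m ih =>
    have h1 := Finset.sum_range_succ (fun i => (m + i) / r) r
    have h2 := Finset.sum_range_succ' (fun i => (m + i) / r) r
    have h3 : (m + r) / r = m / r + 1 := Nat.add_div_right m hr
    have h4 : ∑ i ∈ Finset.range r, (m + 1 + i) / r = ∑ i ∈ Finset.range r, (m + (i + 1)) / r :=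
      Finset.sum_congr rfl fun i _ => by rw [add_right_comm, add_assoc]
    rw [h4]
    simp only [add_zero] at h2
    omega

/-- Any number between `0` and `r * (k - r)` is the excess over `0 + 1 + ⋯ + (r - 1)` of the sum
of `r` distinct naturals below `k`. -/
lemma exists_injective_lt_sum_eq {k r m : ℕ} (hr : 0 < r) (hrk : r ≤ k) (hm : m ≤ r * (k - r)) :
    ∃ c : Fin r → ℕ, Function.Injective c ∧ (∀ i, c i < k) ∧
      ∑ i, c i = m + ∑ i : Fin r, (i : ℕ) := by
  refine ⟨fun i => (m + i) / r + i, StrictMono.injective fun i j hij => ?_, fun i => ?_, ?_⟩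
  · have hij' : (i : ℕ) < j := hij
    have : (m + i) / r ≤ (m + j) / r := Nat.div_le_div_right (by omega)
    show (m + i) / r + i < (m + j) / r + j
    omega
  · have hi := i.isLt
    have : (m + i) / r < k - r + 1 := by
      rw [Nat.div_lt_iff_lt_mul hr]
      calc m + i < r * (k - r) + r := by omega
        _ = (k - r + 1) * r := by ring
    show (m + i) / r + i < k
    omega
  · rw [Finset.sum_add_distrib, Fin.sum_univ_eq_sum_range (fun i => (m + i) / r),
      sum_range_add_div r m hr]

open MvPolynomial in
/-- A set `E` with fewer than `p` and at most `r (|A| - r)` elements misses some sum of `r`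
distinct elements of `A`. -/
lemma exists_injective_sum_notMem {p : ℕ} [Fact p.Prime] {r : ℕ} (hr : 0 < r)
    (A E : Finset (ZMod p)) (hrA : r ≤ A.card) (hEp : E.card < p)
    (hE : E.card ≤ r * (A.card - r)) :
    ∃ s : Fin r → ZMod p, Function.Injective s ∧ (∀ i, s i ∈ A) ∧ ∑ i, s i ∉ E := by
  obtain ⟨c, hinj, hlt, hsum⟩ := exists_injective_lt_sum_eq hr hrA hE
  set c' : Fin r →₀ ℕ := Finsupp.equivFunOnFinite.symm c with hc'
  have hcc (i : Fin r) : c' i = c i := rfl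
  have hAp : A.card ≤ p := by simpa [ZMod.card] using Finset.card_le_univ A
  set V := (Matrix.vandermonde (X : Fin r → MvPolynomial (Fin r) (ZMod p))).det with hV
  set L : MvPolynomial (Fin r) (ZMod p) := ∑ i, X i with hL
  set Q : Polynomial (ZMod p) := ∏ e ∈ E, (Polynomial.X - Polynomial.C e) with hQ
  have hQdeg : Q.natDegree = E.card := Polynomial.natDegree_finsetProd_X_sub_C_eq_card E id
  have hQmonic : Q.Monic := Polynomial.monic_prod_X_sub_C _ _
  have hVL (j : ℕ) : (V * L ^ j).IsHomogeneous (∑ i : Fin r, (i : ℕ) + j) := by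
    have hLh : L.IsHomogeneous 1 := IsHomogeneous.sum _ _ _ fun i _ => isHomogeneous_X _ i
    simpa using (isHomogeneous_det_vandermonde_X r).mul (hLh.pow j)
  have hdeg : c'.degree = E.card + ∑ i : Fin r, (i : ℕ) := by
    rw [Finsupp.degree_eq_sum, ← hsum]; rfl
  have hexp : V * Polynomial.aeval L Q =
      ∑ j ∈ Finset.range (E.card + 1), Q.coeff j • (V * L ^ j) := by
    rw [Polynomial.aeval_eq_sum_range, hQdeg, Finset.mul_sum]
    simp only [mul_smul_comm]
  have hcoeff : coeff c' (V * Polynomial.aeval L Q) = coeff c' (V * L ^ E.card) := by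
    rw [hexp, coeff_sum, Finset.sum_range_succ, Finset.sum_eq_zero, zero_add, coeff_smul,
      ← hQdeg, hQmonic.coeff_natDegree, one_smul]
    intro j hj
    rw [coeff_smul, (hVL j).coeff_eq_zero, smul_zero]
    rw [hdeg]
    have := Finset.mem_range.mp hj
    omega
  have hne : coeff c' (V * Polynomial.aeval L Q) ≠ 0 := by
    rw [hcoeff]
    intro h0
    have key := prod_factorial_mul_coeff_vandermonde_mul_sum_pow (R := ZMod p) E.card c' hsum
    rw [← hV, ← hL, h0, mul_zero, eq_comm, mul_eq_zero] at key
    rcases key with hfac | hdet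
    · rw [ZMod.natCast_eq_zero_iff, (Fact.out : p.Prime).dvd_factorial] at hfac
      omega
    · refine Matrix.det_vandermonde_ne_zero_iff.mpr (fun i j hij => hinj ?_) hdet
      have hij' : ((c i : ℕ) : ZMod p) = (c j : ℕ) := hij
      rw [ZMod.natCast_eq_natCast_iff'] at hij'
      rwa [Nat.mod_eq_of_lt ((hlt i).trans_le hAp),
        Nat.mod_eq_of_lt ((hlt j).trans_le hAp)] at hij'
  have htot : (V * Polynomial.aeval L Q).totalDegree = c'.degree := by
    refine le_antisymm ?_ ?_
    · rw [hexp]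
      refine totalDegree_finsetSum_le fun j hj => (totalDegree_smul_le _ _).trans ?_
      refine (hVL j).totalDegree_le.trans ?_
      have := Finset.mem_range.mp hj
      omega
    · exact le_totalDegree (mem_support_iff.mpr hne)
  obtain ⟨s, hsA, hs⟩ := combinatorial_nullstellensatz_exists_eval_nonzero _ c' hne htot
    (fun _ => A) hlt
  rw [map_mul, mul_ne_zero_iff] at hs
  refine ⟨s, ?_, hsA, fun hmem => hs.2 ?_⟩
  · rw [← Matrix.det_vandermonde_ne_zero_iff]
    convert hs.1
    rw [hV, RingHom.map_det]
    congr 1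
    ext i j
    simp [Matrix.vandermonde_apply]
  · simp only [hQ, map_prod, hL, map_sub, Polynomial.aeval_X, Polynomial.aeval_C, map_sum, eval_X]
    refine Finset.prod_eq_zero hmem ?_
    simp [algebraMap_eq]

/-- The **Dias da Silva–Hamidoune theorem**: a lower bound for the number of sums of `r` distinct
elements of a subset of `ℤ/pℤ`. -/
lemma ZMod.dias_da_silva_hamidoune {p : ℕ} (hp : p.Prime) {r : ℕ} (hr : 0 < r)
    (A : Finset (ZMod p)) (hrA : r ≤ A.card) :
    min p (r * (A.card - r) + 1) ≤ ((A.powersetCard r).image fun s => ∑ a ∈ s, a).card := by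
  have : Fact p.Prime := ⟨hp⟩
  by_contra! hlt
  obtain ⟨E, hCE, hE⟩ := Finset.exists_superset_card_eq
    (n := min p (r * (A.card - r) + 1) - 1) (Nat.le_sub_one_of_lt hlt) (by rw [ZMod.card]; omega)
  have hpos := hp.pos
  obtain ⟨s, hinj, hsA, hs⟩ := exists_injective_sum_notMem hr A E hrA (by omega) (by omega)
  refine hs (hCE (Finset.mem_image.mpr ⟨Finset.univ.map ⟨s, hinj⟩, ?_, by simp⟩))
  rw [Finset.mem_powersetCard]
  exact ⟨fun x hx => by obtain ⟨i, -, rfl⟩ := Finset.mem_map.mp hx; exact hsA i, by simp⟩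

lemma Finset.exists_multiset_of_mem_nsmul {G : Type*} [AddCommMonoid G] [DecidableEq G]
    {A : Finset G} {n : ℕ} {x : G} (hx : x ∈ n • A) :
    ∃ s : Multiset G, (∀ a ∈ s, a ∈ A) ∧ Multiset.card s = n ∧ s.sum = x := by
  induction n generalizing x with
  | zero => exact ⟨0, by simp, by simp, by simpa [eq_comm] using hx⟩
  | succ n ih =>
    rw [succ_nsmul, Finset.mem_add] at hx
    obtain ⟨y, hy, a, ha, rfl⟩ := hx
    obtain ⟨s, hsA, hcard, rfl⟩ := ih hy
    refine ⟨a ::ₘ s, ?_, by simp [hcard], by simp [add_comm]⟩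
    simpa [ha] using hsA

/-- The **Cauchy–Davenport theorem** for iterated sumsets. -/
lemma ZMod.cauchy_davenport_nsmul {p : ℕ} (hp : p.Prime) {A : Finset (ZMod p)}
    (hA : A.Nonempty) (n : ℕ) : min p (n * (A.card - 1) + 1) ≤ (n • A).card := by
  induction n with
  | zero => simp
  | succ n ih =>
    have hcd := ZMod.cauchy_davenport hp (hA.nsmul (n := n)) hA
    have hpos := hA.card_pos
    rw [succ_nsmul, add_mul, one_mul]
    omega

theorem genSumset_card_lower_bound_zmod_p (p : ℕ) (hp : p.Prime) (k r : ℕ)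
    (hk : 1 ≤ k) (hr : 1 ≤ r) (hrk : r ≤ k) (h : ℕ) (hrh : r ≤ h)
    (A : Finset (ZMod p)) (hA : A.card = k) :
    min p (h * (k - 1) - r * (r - 1) + 1) ≤ (genSumset h r A).ncard := by
  have : Fact p.Prime := ⟨hp⟩
  subst hA
  set C := (A.powersetCard r).image fun s => ∑ a ∈ s, a with hC
  have hsub : (((h - r) • A + C : Finset (ZMod p)) : Set (ZMod p)) ⊆ genSumset h r A := by
    intro x hx
    obtain ⟨y, hy, z, hz, rfl⟩ := Finset.mem_add.mp (Finset.mem_coe.mp hx)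
    obtain ⟨s, hsA, hcard, rfl⟩ := Finset.exists_multiset_of_mem_nsmul hy
    obtain ⟨t, ht, rfl⟩ := Finset.mem_image.mp hz
    rw [Finset.mem_powersetCard] at ht
    refine ⟨s + t.val, fun a ha => ?_, ?_, ?_, by rw [Multiset.sum_add, Finset.sum_val]; rfl⟩
    · rw [Multiset.mem_toFinset, Multiset.mem_add] at ha
      exact ha.elim (hsA a) fun h => ht.1 h
    · rw [Multiset.card_add, hcard, Finset.card_val, ht.2]
      omega
    · rw [← ht.2]
      exact Finset.card_le_card fun a ha => by simp [ha]
  have hAne : A.Nonempty := Finset.card_pos.mp hk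
  have hCne : C.Nonempty := (Finset.powersetCard_nonempty.mpr hrk).image _
  have hdsh := ZMod.dias_da_silva_hamidoune hp hr A hrk
  have hcdn := ZMod.cauchy_davenport_nsmul hp hAne (h - r)
  have hcd := ZMod.cauchy_davenport hp (hAne.nsmul (n := h - r)) hCne
  have hle : ((h - r) • A + C).card ≤ (genSumset h r A).ncard := by
    rw [← Set.ncard_coe_finset]
    exact Set.ncard_le_ncard hsub (Set.toFinite _)
  have harith : h * (A.card - 1) - r * (r - 1) =
      (h - r) * (A.card - 1) + r * (A.card - r) := by
    obtain ⟨n, rfl⟩ := Nat.exists_eq_add_of_le hrh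
    obtain ⟨d, hd⟩ := Nat.exists_eq_add_of_le hrk
    obtain ⟨q, rfl⟩ := Nat.exists_eq_add_of_le hr
    rw [hd, Nat.add_sub_cancel_left, Nat.add_sub_cancel_left, Nat.add_sub_cancel_left,
      show 1 + q + d - 1 = q + d by omega]
    refine Nat.sub_eq_of_eq_add ?_
    ring
  rw [harith]
  have hnpos := (hAne.nsmul (n := h - r)).card_pos
  have hCpos := hCne.card_pos
  rw [← hC] at hdsh
  omega
end

section
/- Let $p$ be a prime, and let $k, r$ be positive integers with $k \geq 2$ and $r \leq k$. Let $h \geq r + 2$ be an integer, and let $A$ be a subset of $\mathbb{Z}/p\mathbb{Z}$ with $|A| = k$. If $|h^{(\geq r)}A| = h(k-1) - r(r-1) + 1 \leq p - 2$, then $A$ is an arithmetic progression in $\mathbb{Z}/p\mathbb{Z}$. -/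
open Pointwise

open MvPolynomial in
/-- The coefficient formula: the coefficient of a monomial of maximal degree as a weighted sum of
the values on a grid. -/
theorem MvPolynomial.coeff_eq_sum_piFinset {F σ : Type*} [Field F] [DecidableEq F] [Fintype σ]
    [DecidableEq σ] (S : σ → Finset F) (c : σ →₀ ℕ) (hS : ∀ i, (S i).card = c i + 1)
    (f : MvPolynomial σ F) (hf : f.totalDegree ≤ ∑ i, c i) :
    f.coeff c = ∑ a ∈ Fintype.piFinset S,
      eval a f * ∏ i, (∏ b ∈ (S i).erase (a i), (a i - b))⁻¹ := by
  have key : ∀ (i : σ) (n : ℕ), n ≤ c i →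
      ∑ x ∈ S i, x ^ n * (∏ b ∈ (S i).erase x, (x - b))⁻¹ = if n = c i then 1 else 0 := by
    intro i n hn
    have h := Lagrange.coeff_eq_sum (s := S i) (v := (id : F → F)) (Set.injOn_id _)
      (P := Polynomial.X ^ n) (by rw [Polynomial.degree_X_pow, hS]; exact_mod_cast by omega)
    simp only [hS, Nat.add_sub_cancel, Polynomial.coeff_X_pow, Polynomial.eval_pow,
      Polynomial.eval_X, id, div_eq_mul_inv] at h
    rw [← h]
    simp [eq_comm]
  have mono : ∀ d ∈ f.support,
      ∑ a ∈ Fintype.piFinset S, (∏ i, a i ^ d i) *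
        ∏ i, (∏ b ∈ (S i).erase (a i), (a i - b))⁻¹ = if d = c then 1 else 0 := by
    intro d hd
    simp_rw [← Finset.prod_mul_distrib]
    rw [← Finset.prod_univ_sum S (fun i x => x ^ d i * (∏ b ∈ (S i).erase x, (x - b))⁻¹)]
    have hdeg : ∑ i, d i ≤ ∑ i, c i := by
      refine le_trans ?_ hf
      have := le_totalDegree hd
      rwa [Finsupp.sum_fintype _ _ (fun _ => rfl)] at this
    split_ifs with hdc
    · subst hdc
      exact Finset.prod_eq_one fun i _ => by rw [key i _ le_rfl, if_pos rfl]
    · obtain ⟨i, hi⟩ : ∃ i, d i < c i := by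
        by_contra! hcon
        refine hdc (Finsupp.ext fun i => ?_)
        have := (Finset.sum_eq_sum_iff_of_le (fun i _ => hcon i)).1
          (le_antisymm (Finset.sum_le_sum fun i _ => hcon i) hdeg)
        exact (this i (Finset.mem_univ i)).symm
      refine Finset.prod_eq_zero (Finset.mem_univ i) ?_
      rw [key i _ hi.le, if_neg hi.ne]
  simp_rw [eval_eq', Finset.sum_mul]
  rw [Finset.sum_comm]
  simp_rw [mul_assoc, ← Finset.mul_sum]
  rw [Finset.sum_congr rfl fun d hd => by rw [mono d hd]]
  simp only [mul_ite, mul_one, mul_zero, Finset.sum_ite_eq', mem_support_iff]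
  split_ifs with h
  · rfl
  · simpa using h

open MvPolynomial in
theorem MvPolynomial.totalDegree_prod_sub_C_le {R σ : Type*} [CommRing R]
    (L : MvPolynomial σ R) (hL : L.totalDegree ≤ 1) (D : Multiset R) :
    (D.map fun a => L - C a).prod.totalDegree ≤ Multiset.card D := by
  refine (totalDegree_multiset_prod _).trans ?_
  rw [Multiset.map_map]
  refine (Multiset.sum_le_card_nsmul _ 1 ?_).trans (by simp)
  intro x hx
  obtain ⟨a, -, rfl⟩ := Multiset.mem_map.1 hx
  exact (totalDegree_sub_C_le _ _).trans hL

open MvPolynomial in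
theorem MvPolynomial.coeff_mul_prod_sub_C {R σ : Type*} [CommRing R] [Fintype σ]
    (L : MvPolynomial σ R) (hL : L.totalDegree ≤ 1) (c : σ →₀ ℕ) (C' : Multiset R)
    (P : MvPolynomial σ R) (hP : P.totalDegree + Multiset.card C' ≤ ∑ i, c i) :
    (P * (C'.map fun a => L - C a).prod).coeff c = (P * L ^ Multiset.card C').coeff c := by
  induction C' using Multiset.induction generalizing P with
  | empty => simp
  | cons a D ih =>
    rw [Multiset.card_cons] at hP
    have h1 := ih (P * L) (by have := totalDegree_mul P L; omega)
    have h2 : (P * (D.map fun a => L - C a).prod).coeff c = 0 := by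
      apply coeff_eq_zero_of_totalDegree_lt
      have e : ∑ i ∈ c.support, c i = ∑ i, c i :=
        Finset.sum_subset (Finset.subset_univ _) fun i _ hi => by simpa using hi
      have := totalDegree_mul P (D.map fun a => L - C a).prod
      have := totalDegree_prod_sub_C_le L hL D
      omega
    have e1 : P * ((a ::ₘ D).map fun a => L - C a).prod =
        P * L * (D.map fun a => L - C a).prod - C a * (P * (D.map fun a => L - C a).prod) := by
      rw [Multiset.map_cons, Multiset.prod_cons]; ring
    rw [e1, coeff_sub, coeff_C_mul, h2, h1, Multiset.card_cons, pow_succ']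
    simp [mul_assoc]

theorem Finset.sum_range_card_le_sum (s : Finset ℕ) :
    ∑ i ∈ Finset.range s.card, i ≤ ∑ i ∈ s, i := by
  induction s using Finset.induction_on_max with
  | empty => simp
  | insert a s hlt ih =>
    have ha : a ∉ s := fun h => lt_irrefl _ (hlt a h)
    have hc : s.card ≤ a := by
      simpa using Finset.card_le_card (show s ⊆ Finset.range a from fun x hx => by
        simpa using hlt x hx)
    rw [Finset.card_insert_of_notMem ha, Finset.sum_range_succ, Finset.sum_insert ha]
    omega

theorem Fin.sum_val_le_sum_of_injective {r : ℕ} (n : Fin r → ℕ) (hn : Function.Injective n) :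
    ∑ i : Fin r, (i : ℕ) ≤ ∑ i, n i := by
  have h := Finset.sum_range_card_le_sum (Finset.univ.image n)
  rwa [Finset.card_image_of_injective _ hn, Finset.sum_image hn.injOn, Finset.card_univ,
    Fintype.card_fin, ← Fin.sum_univ_eq_sum_range (fun i => i) r] at h

open MvPolynomial in
/-- The Vandermonde product, as a polynomial. -/
noncomputable def vandermondePoly (R : Type*) [CommRing R] (r : ℕ) : MvPolynomial (Fin r) R :=
  ∏ i : Fin r, ∏ j ∈ Finset.Iio i, (X i - X j)

open MvPolynomial in
theorem totalDegree_vandermondePoly_le (R : Type*) [CommRing R] [Nontrivial R] (r : ℕ) :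
    (vandermondePoly R r).totalDegree ≤ ∑ i : Fin r, (i : ℕ) := by
  refine (totalDegree_finsetProd _ _).trans (Finset.sum_le_sum fun i _ => ?_)
  refine (totalDegree_finsetProd _ _).trans ?_
  refine (Finset.sum_le_card_nsmul _ _ 1 fun j _ => ?_).trans (by simp)
  exact (totalDegree_sub _ _).trans (by simp)

theorem eval_vandermondePoly_ne_zero_iff {R : Type*} [CommRing R] [IsDomain R] {r : ℕ}
    (a : Fin r → R) :
    MvPolynomial.eval a (vandermondePoly R r) ≠ 0 ↔ Function.Injective a := by
  simp only [vandermondePoly, map_prod, map_sub, MvPolynomial.eval_X, Finset.prod_ne_zero_iff,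
    Finset.mem_univ, Finset.mem_Iio, forall_true_left, sub_ne_zero]
  constructor
  · intro h i j hij
    by_contra hne
    rcases lt_or_gt_of_ne hne with hlt | hlt
    · exact h j i hlt hij.symm
    · exact h i j hlt hij
  · intro h i j hji e
    exact hji.ne (h e).symm

open MvPolynomial in
theorem coeff_vandermondePoly_mul_prod_ne_zero {p : ℕ} [Fact p.Prime] {r j : ℕ}
    (hp : r * j < p) (hp' : r + j ≤ p) (c : Fin r →₀ ℕ) (hc : ∀ i, c i = j + i)
    (D : Multiset (ZMod p)) (hD : Multiset.card D = r * j) :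
    (vandermondePoly (ZMod p) r *
      (D.map fun a => (∑ i, X i) - C a).prod).coeff c ≠ 0 := by
  set lo := ∑ i : Fin r, (i : ℕ) with hlo
  have hsumc : ∑ i, c i = lo + r * j := by
    simp [hc, Finset.sum_add_distrib, add_comm, hlo]
  have hVdeg := totalDegree_vandermondePoly_le (ZMod p) r
  have hLdeg : (∑ i : Fin r, X i : MvPolynomial (Fin r) (ZMod p)).totalDegree ≤ 1 :=
    totalDegree_finsetSum_le fun i _ => (totalDegree_X i).le
  set D' : Multiset (ZMod p) := (Finset.Ico lo (lo + r * j)).val.map (fun n : ℕ => (n : ZMod p))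
    with hD'
  have hD'c : Multiset.card D' = r * j := by simp [hD']
  rw [coeff_mul_prod_sub_C _ hLdeg c D _ (by omega), hD, ← hD'c,
    ← coeff_mul_prod_sub_C _ hLdeg c D' _ (by omega)]
  have hcast : ∀ m n : ℕ, m < p → n < p → (m : ZMod p) = n → m = n := by
    intro m n hm hn h
    rw [ZMod.natCast_eq_natCast_iff'] at h
    rwa [Nat.mod_eq_of_lt hm, Nat.mod_eq_of_lt hn] at h
  have hclt : ∀ i, c i < p := fun i => by have := i.2; rw [hc]; omega
  set S : Fin r → Finset (ZMod p) := fun i =>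
    (Finset.range (c i + 1)).image (fun n : ℕ => (n : ZMod p)) with hS
  have hScard : ∀ i, (S i).card = c i + 1 := by
    intro i
    rw [hS, Finset.card_image_of_injOn, Finset.card_range]
    intro m hm n hn h
    have := hclt i
    simp only [Finset.coe_range, Set.mem_Iio] at hm hn
    exact hcast m n (by omega) (by omega) h
  rw [coeff_eq_sum_piFinset S c hScard _ (by
    have := totalDegree_mul (vandermondePoly (ZMod p) r)
      (D'.map fun a => (∑ i, X i : MvPolynomial (Fin r) (ZMod p)) - C a).prod
    have := totalDegree_prod_sub_C_le _ hLdeg D'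
    omega)]
  have heval : ∀ a : Fin r → ZMod p, eval a (D'.map fun b => (∑ i, X i) - C b).prod =
      ∏ n ∈ Finset.Ico lo (lo + r * j), ((∑ i, a i) - (n : ZMod p)) := by
    intro a
    rw [hD', Multiset.map_map]
    change eval a (∏ n ∈ Finset.Ico lo (lo + r * j), _) = _
    simp [map_prod]
  rw [Finset.sum_eq_single (fun i => ((c i : ℕ) : ZMod p))]
  · refine mul_ne_zero ?_ ?_
    · rw [map_mul, heval]
      refine mul_ne_zero ((eval_vandermondePoly_ne_zero_iff _).2 ?_) ?_
      · intro i i' h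
        have := hcast _ _ (hclt i) (hclt i') h
        rw [hc, hc] at this
        exact Fin.ext (by omega)
      · refine Finset.prod_ne_zero_iff.2 fun n hn => ?_
        rw [Finset.mem_Ico] at hn
        rw [← Nat.cast_sum, hsumc, ← Nat.cast_sub hn.2.le, Ne, ZMod.natCast_eq_zero_iff]
        intro hdvd
        have := Nat.le_of_dvd (by omega) hdvd
        omega
    · refine Finset.prod_ne_zero_iff.2 fun i _ => inv_ne_zero ?_
      refine Finset.prod_ne_zero_iff.2 fun b hb => ?_
      rw [sub_ne_zero]
      exact (Finset.ne_of_mem_erase hb).symm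
  · intro a ha hne
    rw [map_mul, heval]
    by_contra h0
    have h1 := left_ne_zero_of_mul (left_ne_zero_of_mul h0)
    have h2 := right_ne_zero_of_mul (left_ne_zero_of_mul h0)
    rw [eval_vandermondePoly_ne_zero_iff] at h1
    rw [Finset.prod_ne_zero_iff] at h2
    have hn : ∀ i, ∃ n : ℕ, n ≤ c i ∧ (n : ZMod p) = a i := by
      intro i
      have := Fintype.mem_piFinset.1 ha i
      obtain ⟨n, hn, e⟩ := Finset.mem_image.1 this
      exact ⟨n, by simpa [Nat.lt_succ_iff] using hn, e⟩
    choose n hn e using hn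
    have hinj : Function.Injective n := fun i i' h => h1 (by rw [← e, ← e, h])
    have hge := Fin.sum_val_le_sum_of_injective n hinj
    have hle := Finset.sum_le_sum fun i (_ : i ∈ Finset.univ) => hn i
    have heq : ∑ i, n i = ∑ i, c i := by
      by_contra hcon
      refine h2 (∑ i, n i) (Finset.mem_Ico.2 ⟨hge, by omega⟩) ?_
      rw [Nat.cast_sum]
      simp [e]
    refine hne (funext fun i => ?_)
    rw [← e, (Finset.sum_eq_sum_iff_of_le fun i _ => hn i).1 heq i (Finset.mem_univ i)]
  · intro h
    refine absurd (Fintype.mem_piFinset.2 fun i => ?_) h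
    exact Finset.mem_image.2 ⟨c i, by simp, rfl⟩

open MvPolynomial in
/-- The Dias da Silva-Hamidoune theorem: a lower bound for the number of sums of `r` distinct
elements of `A`. -/
theorem ZMod.card_image_sum_powersetCard_ge {p : ℕ} [Fact p.Prime] {r j : ℕ}
    (hp : r * j < p) (A : Finset (ZMod p)) (hA : A.card = r + j) :
    r * j + 1 ≤ ((A.powersetCard r).image fun s => ∑ a ∈ s, a).card := by
  by_contra! hlt
  set B := (A.powersetCard r).image fun s => ∑ a ∈ s, a with hB
  have hp' : r + j ≤ p := by
    simpa [hA, ZMod.card] using Finset.card_le_univ A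
  set D : Multiset (ZMod p) := B.val + Multiset.replicate (r * j - B.card) 0 with hD
  have hDc : Multiset.card D = r * j := by
    rw [hD, Multiset.card_add, Multiset.card_replicate, Finset.card_val]; omega
  set c : Fin r →₀ ℕ := Finsupp.equivFunOnFinite.symm fun i => j + i with hcdef
  have hc : ∀ i, c i = j + i := fun i => rfl
  have hsumc : ∑ i, c i = (∑ i : Fin r, (i : ℕ)) + r * j := by
    simp [hc, Finset.sum_add_distrib, add_comm]
  refine coeff_vandermondePoly_mul_prod_ne_zero hp hp' c hc D hDc ?_
  have hex : ∀ i, ∃ T ⊆ A, T.card = c i + 1 := fun i =>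
    Finset.exists_subset_card_eq (by have := i.2; rw [hc, hA]; omega)
  choose S hSA hS using hex
  rw [coeff_eq_sum_piFinset S c hS]
  · refine Finset.sum_eq_zero fun a ha => ?_
    rw [map_mul]
    by_cases hinj : Function.Injective a
    · have hmem : ∑ i, a i ∈ D := by
        rw [hD, Multiset.mem_add]
        left
        rw [Finset.mem_val, hB, Finset.mem_image]
        refine ⟨Finset.univ.image a, Finset.mem_powersetCard.2 ⟨?_, ?_⟩, ?_⟩
        · intro x hx
          obtain ⟨i, -, rfl⟩ := Finset.mem_image.1 hx
          exact hSA i (Fintype.mem_piFinset.1 ha i)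
        · rw [Finset.card_image_of_injective _ hinj, Finset.card_univ, Fintype.card_fin]
        · rw [Finset.sum_image hinj.injOn]
      have h0 : eval a (D.map fun b => (∑ i, X i) - C b).prod = 0 := by
        rw [map_multiset_prod, Multiset.map_map]
        refine Multiset.prod_eq_zero (Multiset.mem_map.2 ⟨_, hmem, ?_⟩)
        simp
      rw [h0, mul_zero, zero_mul]
    · rw [not_not.1 (mt (eval_vandermondePoly_ne_zero_iff a).1 hinj), zero_mul, zero_mul]
  · have h1 := totalDegree_vandermondePoly_le (ZMod p) r
    have h2 : (D.map fun a =>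
      (∑ i, X i : MvPolynomial (Fin r) (ZMod p)) - C a).prod.totalDegree ≤ Multiset.card D :=
      totalDegree_prod_sub_C_le _ (totalDegree_finsetSum_le fun i _ => (totalDegree_X i).le) D
    have := totalDegree_mul (vandermondePoly (ZMod p) r)
      (D.map fun a => (∑ i, X i : MvPolynomial (Fin r) (ZMod p)) - C a).prod
    omega

theorem ZMod.exists_nsmul_eq {p : ℕ} [Fact p.Prime] {d : ZMod p} (hd : d ≠ 0) (z : ZMod p) :
    ∃ n < p, n • d = z :=
  ⟨(z / d).val, ZMod.val_lt _, by
    rw [nsmul_eq_mul, ZMod.natCast_zmod_val, div_mul_cancel₀ _ hd]⟩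

theorem ZMod.eq_of_nsmul_eq_nsmul {p : ℕ} [Fact p.Prime] {d : ZMod p} (hd : d ≠ 0) {m n : ℕ} (hm : m < p)
    (hn : n < p) (h : m • d = n • d) : m = n := by
  rw [nsmul_eq_mul, nsmul_eq_mul] at h
  have h := mul_right_cancel₀ hd h
  rw [ZMod.natCast_eq_natCast_iff'] at h
  rwa [Nat.mod_eq_of_lt hm, Nat.mod_eq_of_lt hn] at h

/-- A finite set in `ℤ/pℤ` which is an arithmetic progression. -/
def IsArithProg {p : ℕ} (A : Finset (ZMod p)) : Prop :=
  ∃ a d : ZMod p, d ≠ 0 ∧ A = Finset.image (fun i : ℕ => a + i • d) (Finset.range A.card)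

theorem isArithProg_of_card_add_pair {p : ℕ} [Fact p.Prime] {A : Finset (ZMod p)} {x y : ZMod p}
    (hxy : x ≠ y) (h : (A + {x, y}).card = A.card + 1) (hlt : A.card < p) : IsArithProg A := by
  set d := y - x with hd
  have hd0 : d ≠ 0 := sub_ne_zero.2 hxy.symm
  set B := A.image (· + d) with hB
  have hBc : B.card = A.card := Finset.card_image_of_injective _ (add_left_injective d)
  have e : A + {x, y} = (A ∪ B).image (· + x) := by
    ext z
    simp only [Finset.mem_add, Finset.mem_insert, Finset.mem_singleton, Finset.mem_image,
      Finset.mem_union, hB]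
    constructor
    · rintro ⟨u, hu, v, rfl | rfl, rfl⟩
      · exact ⟨u, Or.inl hu, rfl⟩
      · exact ⟨u + d, Or.inr ⟨u, hu, rfl⟩, by rw [hd]; ring⟩
    · rintro ⟨w, hw | ⟨u, hu, rfl⟩, rfl⟩
      · exact ⟨w, hw, x, Or.inl rfl, rfl⟩
      · exact ⟨u, hu, y, Or.inr rfl, by rw [hd]; ring⟩
  rw [e, Finset.card_image_of_injective _ (add_left_injective x)] at h
  have hone : (A \ B).card = 1 := by
    have := Finset.card_sdiff_add_card A B
    omega
  obtain ⟨b, hb⟩ := Finset.card_eq_one.1 hone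
  have hbA : b ∈ A := (Finset.mem_sdiff.1 (hb ▸ Finset.mem_singleton_self b)).1
  have hstep : ∀ t ∈ A, t ≠ b → t - d ∈ A := by
    intro t ht htb
    have : t ∈ B := by
      by_contra hcon
      have : t ∈ A \ B := Finset.mem_sdiff.2 ⟨ht, hcon⟩
      rw [hb] at this
      exact htb (Finset.mem_singleton.1 this)
    obtain ⟨u, hu, rfl⟩ := Finset.mem_image.1 this
    simpa using hu
  obtain ⟨z, hz⟩ : ∃ z, z ∉ A := by
    by_contra! hcon
    have : A = Finset.univ := Finset.eq_univ_of_forall hcon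
    rw [this, Finset.card_univ, ZMod.card] at hlt
    omega
  have hex : ∃ n : ℕ, n < p ∧ b + n • d ∉ A := by
    obtain ⟨n, hn, e⟩ := ZMod.exists_nsmul_eq hd0 (z - b)
    exact ⟨n, hn, by rw [e]; simpa using hz⟩
  classical
  set m := Nat.find hex with hm
  obtain ⟨hmp, hmA⟩ : m < p ∧ b + m • d ∉ A := Nat.find_spec hex
  have hmin : ∀ i < m, b + i • d ∈ A := by
    intro i hi
    have := Nat.find_min hex hi
    by_contra hcon
    exact this ⟨by omega, hcon⟩
  set P := Finset.image (fun i : ℕ => b + i • d) (Finset.range m) with hP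
  have hm0 : 0 < m := by
    rcases Nat.eq_zero_or_pos m with h0 | h0
    · rw [h0] at hmA; simp [hbA] at hmA
    · exact h0
  have hbP : b ∈ P := Finset.mem_image.2 ⟨0, by simpa using hm0, by simp⟩
  have hback : ∀ t ∈ A \ P, t - d ∈ A \ P := by
    intro t ht
    obtain ⟨htA, htP⟩ := Finset.mem_sdiff.1 ht
    have htb : t ≠ b := fun h => htP (h ▸ hbP)
    refine Finset.mem_sdiff.2 ⟨hstep t htA htb, fun hcon => ?_⟩
    obtain ⟨i, hi, e⟩ := Finset.mem_image.1 hcon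
    have e' : b + (i + 1) • d = t := by rw [succ_nsmul, ← add_assoc, e]; abel
    rw [Finset.mem_range] at hi
    rcases Nat.lt_or_ge (i + 1) m with h1 | h1
    · exact htP (Finset.mem_image.2 ⟨i + 1, by simpa using h1, e'⟩)
    · have : i + 1 = m := by omega
      rw [this] at e'
      exact hmA (e' ▸ htA)
  have hAP : A = P := by
    apply Finset.Subset.antisymm
    · intro t ht
      by_contra hcon
      have hall : ∀ n : ℕ, t - n • d ∈ A \ P := by
        intro n
        induction n with
        | zero => simpa using ⟨ht, hcon⟩
        | succ n ih =>
          have := hback _ ih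
          rwa [sub_sub, ← succ_nsmul] at this
      obtain ⟨n, -, e⟩ := ZMod.exists_nsmul_eq hd0 (t - b)
      have := hall n
      rw [e, sub_sub_cancel] at this
      exact (Finset.mem_sdiff.1 this).2 hbP
    · intro t ht
      obtain ⟨i, hi, rfl⟩ := Finset.mem_image.1 ht
      exact hmin i (by simpa using hi)
  have hcard : A.card = m := by
    rw [hAP, hP, Finset.card_image_of_injOn, Finset.card_range]
    intro i hi i' hi' h
    simp only [Finset.coe_range, Set.mem_Iio] at hi hi'
    exact ZMod.eq_of_nsmul_eq_nsmul hd0 (by omega) (by omega) (add_left_cancel h)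
  exact ⟨b, d, hd0, by rw [hcard]; exact hAP⟩

/-- `X` is a set with at least two elements such that the pair `A`, `X` is critical for the
Cauchy-Davenport inequality and `A + X` misses at least two elements. -/
def IsFragment {p : ℕ} (A X : Finset (ZMod p)) : Prop :=
  2 ≤ X.card ∧ (A + X).card + 1 = A.card + X.card ∧ (A + X).card + 2 ≤ p

theorem IsFragment.dual {p : ℕ} [Fact p.Prime] {A X : Finset (ZMod p)} (hA : A.Nonempty)
    (hX : IsFragment A X) : IsFragment A (-(A + X)ᶜ) := by
  obtain ⟨h1, h2, h3⟩ := hX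
  have hA' := hA.card_pos
  have hYc : (-(A + X)ᶜ).card = p - (A + X).card := by
    rw [Finset.card_neg, Finset.card_compl, ZMod.card]
  have hsub : A + -(A + X)ᶜ ⊆ -Xᶜ := by
    intro z hz
    obtain ⟨a, ha, y, hy, rfl⟩ := Finset.mem_add.1 hz
    rw [Finset.mem_neg', Finset.mem_compl] at hy ⊢
    intro hcon
    exact hy (Finset.mem_add.2 ⟨a, ha, _, hcon, by ring⟩)
  have hle := Finset.card_le_card hsub
  rw [Finset.card_neg, Finset.card_compl, ZMod.card] at hle
  have hcd := ZMod.cauchy_davenport (Fact.out : p.Prime) hA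
    (Finset.card_pos.1 (show 0 < (-(A + X)ᶜ).card by omega))
  have hXp : X.card ≤ p := by simpa [ZMod.card] using Finset.card_le_univ X
  refine ⟨by omega, ?_, ?_⟩ <;> omega

theorem IsFragment.card_inter_translates_le {p : ℕ} [Fact p.Prime] {A X : Finset (ZMod p)}
    (hA : A.Nonempty) (hX : IsFragment A X) (hmin : ∀ Y, IsFragment A Y → X.card ≤ Y.card)
    {a b : ZMod p} (hab : a ≠ b) : (({a} + X) ∩ ({b} + X)).card ≤ 1 := by
  by_contra! hI
  have hdual := hmin _ (hX.dual hA)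
  rw [Finset.card_neg, Finset.card_compl, ZMod.card] at hdual
  obtain ⟨h1, h2, h3⟩ := hX
  have hA' := hA.card_pos
  have hca : ({a} + X).card = X.card := Finset.card_singleton_add a X
  have hcb : ({b} + X).card = X.card := Finset.card_singleton_add b X
  have hUI := Finset.card_union_add_card_inter ({a} + X) ({b} + X)
  have hIlt : (({a} + X) ∩ ({b} + X)).card < X.card := by
    by_contra! hcon
    have e1 : ({a} + X) ∩ ({b} + X) = {a} + X :=
      Finset.eq_of_subset_of_card_le Finset.inter_subset_left (by omega)
    have e2 : ({a} + X) ∩ ({b} + X) = {b} + X :=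
      Finset.eq_of_subset_of_card_le Finset.inter_subset_right (by omega)
    have e3 : {a} + X = {b} + X := e1.symm.trans e2
    have hstep : ∀ x ∈ X, x + (a - b) ∈ X := by
      intro x hx
      have : a + x ∈ {b} + X := e3 ▸ Finset.add_mem_add (Finset.mem_singleton_self a) hx
      obtain ⟨u, hu, y, hy, e⟩ := Finset.mem_add.1 this
      rw [Finset.mem_singleton.1 hu] at e
      have : x + (a - b) = y := by linear_combination -e
      rwa [this]
    obtain ⟨x, hx⟩ := Finset.card_pos.1 (show 0 < X.card by omega)
    have hall : ∀ n : ℕ, x + n • (a - b) ∈ X := by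
      intro n
      induction n with
      | zero => simpa using hx
      | succ n ih => rw [succ_nsmul, ← add_assoc]; exact hstep _ ih
    have huniv : X = Finset.univ := by
      refine Finset.eq_univ_of_forall fun z => ?_
      obtain ⟨n, -, e⟩ := ZMod.exists_nsmul_eq (sub_ne_zero.2 hab) (z - x)
      have := hall n
      rwa [e, add_sub_cancel] at this
    have : X.card = p := by rw [huniv, Finset.card_univ, ZMod.card]
    omega
  have hAa : (A + ({a} + X)).card = (A + X).card := by
    rw [add_left_comm, Finset.card_singleton_add]
  have hAb : (A + ({b} + X)).card = (A + X).card := by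
    rw [add_left_comm, Finset.card_singleton_add]
  have hsub : A + ({a} + X) ∩ ({b} + X) ⊆ (A + ({a} + X)) ∩ (A + ({b} + X)) :=
    Finset.add_inter_subset
  have hsubc := Finset.card_le_card hsub
  have hsub' := Finset.card_le_card
    (Finset.inter_subset_left (s₁ := A + ({a} + X)) (s₂ := A + ({b} + X)))
  have hUI' := Finset.card_union_add_card_inter (A + ({a} + X)) (A + ({b} + X))
  rw [← Finset.add_union] at hUI'
  have hcdI := ZMod.cauchy_davenport (Fact.out : p.Prime) hA
    (Finset.card_pos.1 (show 0 < (({a} + X) ∩ ({b} + X)).card by omega))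
  have hcdU := ZMod.cauchy_davenport (Fact.out : p.Prime) hA
    (Finset.card_pos.1 (show 0 < (({a} + X) ∪ ({b} + X)).card by omega))
  have hstrict : (A + ({a} + X) ∩ ({b} + X)).card + 1 ≠
      A.card + (({a} + X) ∩ ({b} + X)).card := fun hcon => by
    have := hmin _ ⟨by omega, hcon, by omega⟩
    omega
  omega

/-- **Vosper's theorem**. -/
theorem IsFragment.isArithProg {p : ℕ} [Fact p.Prime] {A X : Finset (ZMod p)}
    (hA : 2 ≤ A.card) (hX : IsFragment A X) : IsArithProg A := by
  induction hn : A.card using Nat.strong_induction_on generalizing A X with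
  | _ n ih =>
  classical
  obtain ⟨X, hX, hmin⟩ : ∃ X, IsFragment A X ∧ ∀ Y, IsFragment A Y → X.card ≤ Y.card := by
    obtain ⟨Z, hZ, hZm⟩ := Finset.exists_min_image (Finset.univ.filter (IsFragment A))
      Finset.card ⟨X, by simpa using hX⟩
    exact ⟨Z, by simpa using hZ, fun Y hY => hZm Y (by simpa using hY)⟩
  have hAne : A.Nonempty := Finset.card_pos.1 (by omega)
  have hinter := fun {a b : ZMod p} (hab : a ≠ b) =>
    hX.card_inter_translates_le hAne hmin hab
  obtain ⟨h1, h2, h3⟩ := hX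
  rcases h1.eq_or_lt with hX2 | hX3
  · obtain ⟨x, y, hxy, rfl⟩ := Finset.card_eq_two.1 hX2.symm
    exact isArithProg_of_card_add_pair hxy (by omega) (by omega)
  have htr : ∀ a ∈ A, {a} + X ⊆ A + X := fun a ha =>
    Finset.add_subset_add_right (Finset.singleton_subset_iff.2 ha)
  have hc : ∀ a : ZMod p, ({a} + X).card = X.card := fun a => Finset.card_singleton_add a X
  have hunion : ∀ a b : ZMod p, a ≠ b → 2 * X.card ≤ (({a} + X) ∪ ({b} + X)).card + 1 := by
    intro a b hab
    have := Finset.card_union_add_card_inter ({a} + X) ({b} + X)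
    have := hinter hab
    rw [hc, hc] at *
    omega
  have hA3 : 2 < A.card := by
    obtain ⟨a, ha, b, hb, hab⟩ := Finset.one_lt_card.1 (show 1 < A.card by omega)
    have := Finset.card_le_card (Finset.union_subset (htr a ha) (htr b hb))
    have := hunion a b hab
    omega
  have hlt : X.card < A.card := by
    obtain ⟨a, b, c, ha, hb, hc', hab, hac, hbc⟩ := Finset.two_lt_card_iff.1 hA3
    have h4 := Finset.card_le_card
      (Finset.union_subset (Finset.union_subset (htr a ha) (htr b hb)) (htr c hc'))
    have h5 := hunion a b hab
    have h6 := Finset.card_union_add_card_inter (({a} + X) ∪ ({b} + X)) ({c} + X)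
    rw [Finset.union_inter_distrib_right, hc] at h6
    have h7 := Finset.card_union_le (({a} + X) ∩ ({c} + X)) (({b} + X) ∩ ({c} + X))
    have h8 := hinter hac
    have h9 := hinter hbc
    omega
  obtain ⟨a, d, hd, hXe⟩ := ih X.card (by omega) (A := X) (X := A) (by omega)
    ⟨hA, by rw [add_comm X A]; omega, by rw [add_comm X A]; omega⟩ rfl
  have hmem : ∀ i < X.card, a + i • d ∈ X := fun i hi => by
    rw [hXe]; exact Finset.mem_image.2 ⟨i, by simpa using hi, rfl⟩
  have h0 := hinter (a := 0) (b := d) hd.symm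
  refine absurd h0 (not_le.2 (Finset.one_lt_card.2
    ⟨a + d, ?_, a + 2 • d, ?_, fun h => hd ?_⟩))
  · refine Finset.mem_inter.2 ⟨Finset.mem_add.2 ⟨0, by simp, a + 1 • d, hmem 1 (by omega), by simp⟩,
      Finset.mem_add.2 ⟨d, by simp, a + 0 • d, hmem 0 (by omega), by simp [add_comm]⟩⟩
  · refine Finset.mem_inter.2 ⟨Finset.mem_add.2 ⟨0, by simp, a + 2 • d, hmem 2 (by omega), by simp⟩,
      Finset.mem_add.2 ⟨d, by simp, a + 1 • d, hmem 1 (by omega), by simp; ring⟩⟩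
  · rw [two_nsmul] at h
    simpa using add_left_cancel h

theorem genSumset_succ {G : Type*} [AddCommGroup G] [DecidableEq G] {h r : ℕ} (hr : r ≤ h)
    (A : Finset G) : genSumset (h + 1) r A = genSumset h r A + (A : Set G) := by
  ext x
  constructor
  · rintro ⟨s, hsA, hsc, hsr, rfl⟩
    obtain ⟨a, ha, hac⟩ : ∃ a ∈ s, r ≤ (s.erase a).toFinset.card := by
      by_cases hnd : s.Nodup
      · obtain ⟨a, ha⟩ := Multiset.card_pos_iff_exists_mem.1 (show 0 < Multiset.card s by omega)
        refine ⟨a, ha, ?_⟩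
        rw [Multiset.toFinset_card_of_nodup (hnd.erase a), Multiset.card_erase_of_mem ha, hsc]
        exact hr
      · obtain ⟨a, ha⟩ : ∃ a, 1 < s.count a := by
          by_contra! hcon
          exact hnd (Multiset.nodup_iff_count_le_one.2 hcon)
        refine ⟨a, Multiset.count_pos.1 (by omega), hsr.trans (Finset.card_le_card ?_)⟩
        intro y hy
        rw [Multiset.mem_toFinset] at hy ⊢
        by_cases hya : y = a
        · subst hya
          rw [← Multiset.count_pos, Multiset.count_erase_self]
          omega
        · exact (Multiset.mem_erase_of_ne hya).2 hy
    refine Set.mem_add.2 ⟨(s.erase a).sum, ⟨s.erase a, fun y hy => hsA ?_, ?_, hac, rfl⟩, a,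
      hsA (Multiset.mem_toFinset.2 ha), ?_⟩
    · exact Multiset.mem_toFinset.2 (Multiset.mem_of_mem_erase (Multiset.mem_toFinset.1 hy))
    · rw [Multiset.card_erase_of_mem ha, hsc]; rfl
    · rw [add_comm, Multiset.sum_erase ha]
  · rintro ⟨_, ⟨s, hsA, hsc, hsr, rfl⟩, a, ha, rfl⟩
    refine ⟨a ::ₘ s, ?_, by simp [hsc], hsr.trans (Finset.card_le_card ?_), ?_⟩
    · rw [Multiset.toFinset_cons]
      exact Finset.insert_subset ha hsA
    · rw [Multiset.toFinset_cons]
      exact Finset.subset_insert _ _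
    · simp [add_comm]

theorem ZMod.exists_finset_eq_genSumset {p : ℕ} [Fact p.Prime] {r j : ℕ} (hp : r * j < p)
    (A : Finset (ZMod p)) (hA : A.card = r + j) (hA0 : A.Nonempty) (t : ℕ) :
    ∃ X : Finset (ZMod p), (X : Set (ZMod p)) = genSumset (r + t) r A ∧
      min p (r * j + 1 + t * (A.card - 1)) ≤ X.card := by
  induction t with
  | zero =>
    refine ⟨(Set.toFinite (genSumset (r + 0) r A)).toFinset, by simp, ?_⟩
    rw [zero_mul, add_zero]
    refine (min_le_right _ _).trans
      ((ZMod.card_image_sum_powersetCard_ge hp A hA).trans (Finset.card_le_card ?_))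
    intro x hx
    obtain ⟨s, hs, rfl⟩ := Finset.mem_image.1 hx
    obtain ⟨hsA, hsc⟩ := Finset.mem_powersetCard.1 hs
    rw [Set.Finite.mem_toFinset]
    exact ⟨s.val, by simpa using hsA, hsc, by simp [hsc], by simp [Finset.sum_val]⟩
  | succ t ih =>
    obtain ⟨X, hX, hXc⟩ := ih
    refine ⟨X + A, ?_, ?_⟩
    · rw [Finset.coe_add, hX, ← genSumset_succ (by omega)]; rfl
    · have hp' := (Fact.out : p.Prime).pos
      have hcd := ZMod.cauchy_davenport (Fact.out : p.Prime)
        (Finset.card_pos.1 (show 0 < X.card by omega)) hA0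
      have := hA0.card_pos
      rw [add_mul, one_mul]
      omega

theorem genSumset_inverse_zmod_p (p : ℕ) (hp : p.Prime) (k r : ℕ)
    (hk : 2 ≤ k) (hr : 1 ≤ r) (hrk : r ≤ k) (h : ℕ) (hh : r + 2 ≤ h)
    (A : Finset (ZMod p)) (hA : A.card = k)
    (hcard : (genSumset h r A).ncard = h * (k - 1) - r * (r - 1) + 1)
    (hle : h * (k - 1) - r * (r - 1) + 1 ≤ p - 2) :
    ∃ a d : ZMod p, d ≠ 0 ∧
      A = Finset.image (fun i : ℕ => a + i • d) (Finset.range k) := by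
  have : Fact p.Prime := ⟨hp⟩
  obtain ⟨j, rfl⟩ := Nat.exists_eq_add_of_le hrk
  obtain ⟨t, rfl⟩ := Nat.exists_eq_add_of_le hh
  have hform : (r + 2 + t) * (r + j - 1) - r * (r - 1) =
      r * j + (t + 1) * (r + j - 1) + (r + j - 1) := by
    obtain ⟨q, rfl⟩ := Nat.exists_eq_add_of_le hr
    have e1 : 1 + q + j - 1 = q + j := by omega
    have e2 : 1 + q - 1 = q := by omega
    rw [e1, e2]
    apply Nat.sub_eq_of_eq_add
    ring
  rw [hform] at hcard hle
  obtain ⟨X, hX, hXc⟩ := ZMod.exists_finset_eq_genSumset (by omega) A hA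
    (Finset.card_pos.1 (by omega)) (t + 1)
  have hsum : (A + X).card = r * j + (t + 1) * (r + j - 1) + (r + j - 1) + 1 := by
    rw [← hcard, show r + 2 + t = r + (t + 1) + 1 by ring, genSumset_succ (by omega), ← hX,
      ← Finset.coe_add, Set.ncard_coe_finset, add_comm A X]
  rw [hA] at hXc
  have hpos : 1 * (r + j - 1) ≤ (t + 1) * (r + j - 1) := Nat.mul_le_mul_right _ (by omega)
  have hcd := ZMod.cauchy_davenport hp (Finset.card_pos.1 (show 0 < A.card by omega))
    (Finset.card_pos.1 (show 0 < X.card by omega))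
  have hfrag : IsFragment A X := ⟨by omega, by omega, by omega⟩
  simpa only [IsArithProg, hA] using hfrag.isArithProg (by omega)
end
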